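/- arXiv:2005.10968 — 2 statements merged into one kernel-verified Lean document; each statement's English description precedes it below -/
import Mathlib

section
/- Let S be a nonempty subset of ℕA such that no two distinct elements of S are comparable with respect to divisibility (i.e., for all distinct a, b ∈ S, a − b ∉ ℕA and b − a ∉ ℕA). Then S is finite. -/
open scoped BigOperators

namespace StdPairsPaper

/-- The coercion of a lattice point to a real vector. -/
def toR {d : ℕ} (v : Fin d → ℤ) : Fin d → ℝ := fun i => (v i : ℝ)

/-- The cone of nonnegative real combinations of (the real images of) elements of `S`. -/
def cone {d : ℕ} (S : Set (Fin d → ℤ)) : Set (Fin d → ℝ) :=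
  {x | ∃ (t : Finset (Fin d → ℤ)) (c : (Fin d → ℤ) → ℝ),
    (t : Set (Fin d → ℤ)) ⊆ S ∧ (∀ v, 0 ≤ c v) ∧ x = ∑ v ∈ t, c v • toR v}

/-- `ℕS`, the submonoid of `ℤ^d` generated by `S`. -/
def NSemi {d : ℕ} (S : Set (Fin d → ℤ)) : AddSubmonoid (Fin d → ℤ) :=
  AddSubmonoid.closure S

/-- `ℤS`, the subgroup of `ℤ^d` generated by `S`. -/
def ZGrp {d : ℕ} (S : Set (Fin d → ℤ)) : AddSubgroup (Fin d → ℤ) :=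
  AddSubgroup.closure S

/-- `ℝS`, the real linear span of `S`. -/
def RSpan {d : ℕ} (S : Set (Fin d → ℤ)) : Submodule ℝ (Fin d → ℝ) :=
  Submodule.span ℝ (toR '' S)

/-- `A` is a configuration: a finite set of nonzero lattice points whose `ℤ`-span is `ℤ^d`
and whose nonnegative real cone is strongly convex (contains no line, i.e. is pointed). -/
structure IsConfig {d : ℕ} (A : Set (Fin d → ℤ)) : Prop where
  (finite : A.Finite)
  (nonzero : (0 : Fin d → ℤ) ∉ A)
  (spans : ZGrp A = ⊤)
  (pointed : ∀ x ∈ cone A, -x ∈ cone A → x = 0)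

/-- `F` is a face of the configuration `A`: `F ⊆ A`, the cone over `F` is an extreme
subset (face) of the cone over `A`, and `ℝ_{≥0}F ∩ A = F`. -/
def IsFace {d : ℕ} (A F : Set (Fin d → ℤ)) : Prop :=
  F ⊆ A ∧ IsExtreme ℝ (cone A) (cone F) ∧ cone F ∩ (toR '' A) = toR '' F

/-- The set `a + ℕF`. -/
def cell {d : ℕ} (a : Fin d → ℤ) (F : Set (Fin d → ℤ)) : Set (Fin d → ℤ) :=
  {x | ∃ f ∈ NSemi F, x = a + f}

/-- Two pairs `(a,F)` and `(b,F)` belonging to the same face `F` overlap: `a - b ∈ ℤF`. -/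
def Overlap {d : ℕ} (F : Set (Fin d → ℤ)) (a b : Fin d → ℤ) : Prop :=
  a - b ∈ ZGrp F

/-- The pair `(a,F)` divides the pair `(b,G)`:
there is `c ∈ ℕA` with `a + c + ℕF ⊆ b + ℕG`. -/
def PairDvd {d : ℕ} (A : Set (Fin d → ℤ)) (a : Fin d → ℤ) (F : Set (Fin d → ℤ))
    (b : Fin d → ℤ) (G : Set (Fin d → ℤ)) : Prop :=
  ∃ c ∈ NSemi A, cell (a + c) F ⊆ cell b G

/-- `E` is the exponent set of a monomial ideal of `ℕA`: `E ⊆ ℕA` and `E + ℕA ⊆ E`. -/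
def IsExpSet {d : ℕ} (A E : Set (Fin d → ℤ)) : Prop :=
  E ⊆ (NSemi A : Set (Fin d → ℤ)) ∧ ∀ e ∈ E, ∀ c ∈ NSemi A, e + c ∈ E

/-- The standard monomials of `E`: `ℕA ∖ E`. -/
def stdSet {d : ℕ} (A E : Set (Fin d → ℤ)) : Set (Fin d → ℤ) :=
  (NSemi A : Set (Fin d → ℤ)) \ E

/-- `(a,F)` is a proper pair of `E`: a pair of `A` with `a + ℕF ⊆ std(E)`. -/
def ProperPair {d : ℕ} (A E : Set (Fin d → ℤ)) (a : Fin d → ℤ)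
    (F : Set (Fin d → ℤ)) : Prop :=
  a ∈ NSemi A ∧ IsFace A F ∧ cell a F ⊆ stdSet A E

/-- `(a,F)` is a standard pair of `E`: a proper pair of `E` maximal with respect to
the partial order `(a,F) ≼ (b,G) ↔ a + ℕF ⊆ b + ℕG`. -/
def StdPair {d : ℕ} (A E : Set (Fin d → ℤ)) (a : Fin d → ℤ)
    (F : Set (Fin d → ℤ)) : Prop :=
  ProperPair A E a F ∧
    ∀ b G, ProperPair A E b G → cell a F ⊆ cell b G → cell b G ⊆ cell a F

/-- The overlap class of the standard pair `(a,F)` of `E` is maximal with respect to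
divisibility among overlap classes of standard pairs of `E`. -/
def MaxClass {d : ℕ} (A E : Set (Fin d → ℤ)) (a : Fin d → ℤ)
    (F : Set (Fin d → ℤ)) : Prop :=
  ∀ b G, StdPair A E b G → PairDvd A a F b G → PairDvd A b G a F

noncomputable section

/-- The affine semigroup ring `k[ℕA]`. -/
abbrev SGRing {d : ℕ} (k : Type*) [Field k] (A : Set (Fin d → ℤ)) :=
  AddMonoidAlgebra k (NSemi A)

/-- The monomial `t^a` of `k[ℕA]`. -/
def mono {d : ℕ} (k : Type*) [Field k] (A : Set (Fin d → ℤ)) (a : (NSemi A)) :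
    SGRing k A :=
  AddMonoidAlgebra.single a 1

/-- `I` is a monomial ideal of `k[ℕA]`: an ideal generated by monomials. -/
def IsMonomialIdeal {d : ℕ} (k : Type*) [Field k] (A : Set (Fin d → ℤ))
    (I : Ideal (SGRing k A)) : Prop :=
  ∃ S : Set (NSemi A), I = Ideal.span ((fun a => mono k A a) '' S)

/-- The exponent set `E(I) = {a ∈ ℕA : t^a ∈ I}` of an ideal of `k[ℕA]`,
as a subset of `ℤ^d`. -/
def expSet {d : ℕ} (k : Type*) [Field k] (A : Set (Fin d → ℤ))
    (I : Ideal (SGRing k A)) : Set (Fin d → ℤ) :=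
  {x | ∃ h : x ∈ NSemi A, mono k A ⟨x, h⟩ ∈ I}

/-- The monomial prime ideal `p_F = ⟨t^a : a ∈ ℕA ∖ ℕF⟩` of `k[ℕA]`. -/
def primeF {d : ℕ} (k : Type*) [Field k] (A F : Set (Fin d → ℤ)) :
    Ideal (SGRing k A) :=
  Ideal.span {x | ∃ a : (NSemi A), (a : Fin d → ℤ) ∉ NSemi F ∧ x = mono k A a}

end


/-- **Dickson's Lemma for affine semigroups.**
Let `S` be a nonempty subset of `ℕA` such that no two distinct elements of `S` are
comparable with respect to divisibility. Then `S` is finite. -/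
theorem dickson_for_affine_semigroups {d : ℕ} (A : Set (Fin d → ℤ)) (hA : IsConfig A)
    (S : Set (Fin d → ℤ)) (hSA : S ⊆ (NSemi A : Set (Fin d → ℤ))) (hne : S.Nonempty)
    (hinc : ∀ a ∈ S, ∀ b ∈ S, a ≠ b → a - b ∉ NSemi A ∧ b - a ∉ NSemi A) :
    S.Finite := by
  have := hA.finite.to_subtype
  have := Fintype.ofFinite A
  have hcoeff : ∀ x ∈ S, ∃ f : A → ℕ, x = ∑ a, f a • (a : Fin d → ℤ) :=
    fun x hx => AddSubmonoid.mem_closure_iff_of_fintype.1 (hSA hx)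
  choose! g hg using hcoeff
  have hdvd : ∀ x ∈ S, ∀ y ∈ S, g x ≤ g y → y - x ∈ NSemi A := fun x hx y hy hle => by
    have hsub : y - x = ∑ a, (g y a - g x a) • (a : Fin d → ℤ) := by
      conv_lhs => rw [hg x hx, hg y hy, ← Finset.sum_sub_distrib]
      exact Finset.sum_congr rfl fun a _ => by rw [sub_nsmul _ (hle a), sub_eq_add_neg]
    rw [hsub]
    exact sum_mem fun a _ => nsmul_mem (AddSubmonoid.subset_closure a.2) _
  have hanti : IsAntichain (· ≤ ·) (g '' S) := by
    rintro _ ⟨x, hx, rfl⟩ _ ⟨y, hy, rfl⟩ hxy hle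
    exact (hinc x hx y hy (ne_of_apply_ne g hxy)).2 (hdvd x hx y hy hle)
  have hinj : Set.InjOn g S := fun x hx y hy h => by rw [hg x hx, hg y hy, h]
  exact (hanti.finite_of_partiallyWellOrderedOn (Set.isPWO_of_wellQuasiOrderedLE _)).of_finite_image
    hinj

end StdPairsPaper
end

section
/- Suppose the pair (a,F) divides the pair (b,G). If (a',F) overlaps (a,F) and (b',G) overlaps (b,G), then (a',F) divides (b',G). Consequently divisibility induces a well-defined relation on overlap classes of pairs of A, and this relation is a partial order: it is reflexive, transitive, and if (a,F) divides (b,G) and (b,G) divides (a,F), then F = G and (a,F) overlaps (b,G). -/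
open scoped BigOperators

namespace StdPairsPaper

section

variable {d : ℕ}

theorem toR_add (x y : Fin d → ℤ) : toR (x + y) = toR x + toR y := by
  ext i
  simp [toR]

theorem toR_zero : toR (0 : Fin d → ℤ) = 0 := by
  ext i
  simp [toR]

theorem toR_injective : Function.Injective (toR (d := d)) := fun x y h => by
  ext i
  have := congrFun h i
  simpa [toR] using this

theorem zero_mem_cone (S : Set (Fin d → ℤ)) : (0 : Fin d → ℝ) ∈ cone S :=
  ⟨∅, 0, by simp, by simp, by simp⟩

theorem add_mem_cone {S : Set (Fin d → ℤ)} {x y : Fin d → ℝ} (hx : x ∈ cone S)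
    (hy : y ∈ cone S) : x + y ∈ cone S := by
  classical
  obtain ⟨t, c, ht, hc, rfl⟩ := hx
  obtain ⟨u, e, hu, he, rfl⟩ := hy
  refine ⟨t ∪ u, fun v => (if v ∈ t then c v else 0) + (if v ∈ u then e v else 0), ?_, ?_, ?_⟩
  · simpa using ⟨ht, hu⟩
  · intro v
    have := hc v
    have := he v
    positivity
  · simp only [add_smul, Finset.sum_add_distrib, ite_smul, zero_smul, Finset.sum_ite_mem]
    rw [Finset.inter_eq_right.2 Finset.subset_union_left,
      Finset.inter_eq_right.2 Finset.subset_union_right]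

theorem smul_mem_cone {S : Set (Fin d → ℤ)} {x : Fin d → ℝ} {r : ℝ} (hr : 0 ≤ r)
    (hx : x ∈ cone S) : r • x ∈ cone S := by
  obtain ⟨t, c, ht, hc, rfl⟩ := hx
  refine ⟨t, fun v => r * c v, ht, fun v => mul_nonneg hr (hc v), ?_⟩
  simp only [Finset.smul_sum, smul_smul]

theorem toR_mem_cone_of_mem {S : Set (Fin d → ℤ)} {x : Fin d → ℤ} (hx : x ∈ S) :
    toR x ∈ cone S :=
  ⟨{x}, fun _ => 1, by simpa using hx, fun _ => zero_le_one, by simp⟩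

theorem toR_mem_cone {S : Set (Fin d → ℤ)} {x : Fin d → ℤ} (hx : x ∈ NSemi S) :
    toR x ∈ cone S := by
  induction hx using AddSubmonoid.closure_induction with
  | mem x hx => exact toR_mem_cone_of_mem hx
  | zero => exact toR_zero ▸ zero_mem_cone S
  | add x y _ _ ihx ihy => exact toR_add x y ▸ add_mem_cone ihx ihy

theorem NSemi_mono {S T : Set (Fin d → ℤ)} (h : S ⊆ T) : NSemi S ≤ NSemi T :=
  AddSubmonoid.closure_mono h

theorem NSemi_subset_ZGrp {S : Set (Fin d → ℤ)} {x : Fin d → ℤ} (hx : x ∈ NSemi S) :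
    x ∈ ZGrp S :=
  AddSubgroup.le_closure_toAddSubmonoid S hx

/-- Every element of `ℤS` is a difference of two elements of `ℕS`. -/
theorem exists_add_eq_of_mem_ZGrp {S : Set (Fin d → ℤ)} {x : Fin d → ℤ} (hx : x ∈ ZGrp S) :
    ∃ p ∈ NSemi S, ∃ q ∈ NSemi S, x + q = p := by
  induction hx using AddSubgroup.closure_induction with
  | mem x hx => exact ⟨x, AddSubmonoid.subset_closure hx, 0, zero_mem _, add_zero x⟩
  | zero => exact ⟨0, zero_mem _, 0, zero_mem _, add_zero 0⟩
  | add x y _ _ ihx ihy =>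
    obtain ⟨p, hp, q, hq, rfl⟩ := ihx
    obtain ⟨p', hp', q', hq', rfl⟩ := ihy
    exact ⟨_, add_mem hp hp', _, add_mem hq hq', by abel⟩
  | neg x _ ih =>
    obtain ⟨p, hp, q, hq, rfl⟩ := ih
    exact ⟨q, hq, _, hp, by abel⟩

variable {A F G : Set (Fin d → ℤ)}

theorem IsFace.left_mem_cone (hF : IsFace A F) {x y : Fin d → ℝ} (hx : x ∈ cone A)
    (hy : y ∈ cone A) (hxy : x + y ∈ cone F) : x ∈ cone F := by
  have h : (2 : ℝ) • x ∈ cone F := by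
    refine hF.2.1.left_mem_of_mem_openSegment (smul_mem_cone zero_le_two hx)
      (smul_mem_cone zero_le_two hy) hxy ⟨1 / 2, 1 / 2, by norm_num, by norm_num, by norm_num, ?_⟩
    simp [smul_smul]
  simpa [smul_smul] using smul_mem_cone (r := 1 / 2) (by norm_num) h

theorem IsFace.mem_of_toR_mem_cone (hF : IsFace A F) {x : Fin d → ℤ} (hx : x ∈ A)
    (h : toR x ∈ cone F) : x ∈ F := by
  have : toR x ∈ toR '' F := hF.2.2 ▸ ⟨h, x, hx, rfl⟩
  exact toR_injective.mem_set_image.1 this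

theorem IsFace.mem_NSemi_of_toR_mem_cone (hF : IsFace A F) {x : Fin d → ℤ} (hx : x ∈ NSemi A)
    (h : toR x ∈ cone F) : x ∈ NSemi F := by
  induction hx using AddSubmonoid.closure_induction with
  | mem x hx => exact AddSubmonoid.subset_closure (hF.mem_of_toR_mem_cone hx h)
  | zero => exact zero_mem _
  | add x y hx hy ihx ihy =>
    rw [toR_add] at h
    exact add_mem (ihx (hF.left_mem_cone (toR_mem_cone hx) (toR_mem_cone hy) h))
      (ihy (hF.left_mem_cone (toR_mem_cone hy) (toR_mem_cone hx) (add_comm (toR x) _ ▸ h)))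

/-- `ℕF` is a face of the monoid `ℕA`. -/
theorem IsFace.left_mem_NSemi (hF : IsFace A F) {x y : Fin d → ℤ} (hx : x ∈ NSemi A)
    (hy : y ∈ NSemi A) (hxy : x + y ∈ NSemi F) : x ∈ NSemi F :=
  hF.mem_NSemi_of_toR_mem_cone hx <| hF.left_mem_cone (toR_mem_cone hx) (toR_mem_cone hy)
    (toR_add x y ▸ toR_mem_cone hxy)

theorem pairDvd_iff (hF : F ⊆ A) (hG : IsFace A G) {a b : Fin d → ℤ} :
    PairDvd A a F b G ↔ F ⊆ G ∧ ∃ c ∈ NSemi A, ∃ g ∈ NSemi G, a + c = b + g := by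
  constructor
  · rintro ⟨c, hc, h⟩
    obtain ⟨g, hg, hacg⟩ := h ⟨0, zero_mem _, (add_zero _).symm⟩
    refine ⟨fun f hf => ?_, c, hc, g, hg, hacg⟩
    obtain ⟨g', hg', hfg⟩ := h ⟨f, AddSubmonoid.subset_closure hf, rfl⟩
    have hsum : f + g = g' := by
      rw [hacg, add_assoc] at hfg
      rw [add_comm, add_left_cancel hfg]
    refine hG.mem_of_toR_mem_cone (hF hf) (toR_mem_cone ?_)
    exact hG.left_mem_NSemi (AddSubmonoid.subset_closure (hF hf)) (NSemi_mono hG.1 hg)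
      (hsum ▸ hg')
  · rintro ⟨hFG, c, hc, g, hg, h⟩
    refine ⟨c, hc, ?_⟩
    rintro _ ⟨f, hf, rfl⟩
    exact ⟨g + f, add_mem hg (NSemi_mono hFG hf), by rw [h, add_assoc]⟩

theorem PairDvd.of_overlap (hF : IsFace A F) (hG : IsFace A G) {a a' b b' : Fin d → ℤ}
    (h : PairDvd A a F b G) (ha : Overlap F a' a) (hb : Overlap G b' b) :
    PairDvd A a' F b' G := by
  rw [pairDvd_iff hF.1 hG] at h ⊢
  obtain ⟨hFG, c, hc, g, hg, h⟩ := h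
  obtain ⟨p, hp, q, hq, hpq⟩ := exists_add_eq_of_mem_ZGrp ha
  obtain ⟨r, hr, s, hs, hrs⟩ := exists_add_eq_of_mem_ZGrp hb
  refine ⟨hFG, c + q + r, add_mem (add_mem hc (NSemi_mono hF.1 hq)) (NSemi_mono hG.1 hr),
    g + p + s, add_mem (add_mem hg (NSemi_mono hFG hp)) hs, ?_⟩
  linear_combination h + hpq - hrs

theorem PairDvd.refl (a : Fin d → ℤ) : PairDvd A a F a F :=
  ⟨0, zero_mem _, by rw [add_zero]⟩

theorem PairDvd.trans {H : Set (Fin d → ℤ)} {a b c : Fin d → ℤ} (h₁ : PairDvd A a F b G)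
    (h₂ : PairDvd A b G c H) : PairDvd A a F c H := by
  obtain ⟨u, hu, h₁⟩ := h₁
  obtain ⟨v, hv, h₂⟩ := h₂
  refine ⟨u + v, add_mem hu hv, ?_⟩
  rintro _ ⟨f, hf, rfl⟩
  obtain ⟨g, hg, h⟩ := h₁ ⟨f, hf, rfl⟩
  exact h₂ ⟨g, hg, by linear_combination h⟩

theorem PairDvd.antisymm (hF : IsFace A F) (hG : IsFace A G) {a b : Fin d → ℤ}
    (h₁ : PairDvd A a F b G) (h₂ : PairDvd A b G a F) : F = G ∧ Overlap F a b := by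
  obtain ⟨hFG, u, hu, g, hg, hab⟩ := (pairDvd_iff hF.1 hG).1 h₁
  obtain ⟨hGF, v, hv, f, hf, hba⟩ := (pairDvd_iff hG.1 hF).1 h₂
  obtain rfl := hFG.antisymm hGF
  have huv : u + v = g + f := by linear_combination hab + hba
  have huF := hF.left_mem_NSemi hu hv (huv ▸ add_mem hg hf)
  have hsub : a - b = g - u := by linear_combination hab
  refine ⟨rfl, ?_⟩
  rw [Overlap, hsub]
  exact sub_mem (NSemi_subset_ZGrp hg) (NSemi_subset_ZGrp huF)

end

/-- If `(a,F)` divides `(b,G)`, `(a',F)` overlaps `(a,F)` and `(b',G)`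
overlaps `(b,G)`, then `(a',F)` divides `(b',G)`.  Consequently divisibility is a
well-defined relation on overlap classes of pairs of `A`, and it is a partial order:
reflexive, transitive, and antisymmetric in the sense that mutual divisibility of
`(a,F)` and `(b,G)` forces `F = G` and `(a,F)` overlapping `(b,G)`. -/
theorem pairDvd_wellDefined_on_overlap_classes_and_partialOrder {d : ℕ}
    (A : Set (Fin d → ℤ)) (hA : IsConfig A) :
    (∀ (a a' b b' : Fin d → ℤ) (F G : Set (Fin d → ℤ)),
      a ∈ NSemi A → a' ∈ NSemi A → b ∈ NSemi A → b' ∈ NSemi A →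
      IsFace A F → IsFace A G →
      PairDvd A a F b G → Overlap F a' a → Overlap G b' b → PairDvd A a' F b' G) ∧
    (∀ (a : Fin d → ℤ) (F : Set (Fin d → ℤ)),
      a ∈ NSemi A → IsFace A F → PairDvd A a F a F) ∧
    (∀ (a b c : Fin d → ℤ) (F G H : Set (Fin d → ℤ)),
      a ∈ NSemi A → b ∈ NSemi A → c ∈ NSemi A →
      IsFace A F → IsFace A G → IsFace A H →
      PairDvd A a F b G → PairDvd A b G c H → PairDvd A a F c H) ∧
    (∀ (a b : Fin d → ℤ) (F G : Set (Fin d → ℤ)),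
      a ∈ NSemi A → b ∈ NSemi A → IsFace A F → IsFace A G →
      PairDvd A a F b G → PairDvd A b G a F → F = G ∧ Overlap F a b) := by
  exact ⟨fun _ _ _ _ _ _ _ _ _ _ hF hG => PairDvd.of_overlap hF hG,
    fun a _ _ _ => PairDvd.refl a,
    fun _ _ _ _ _ _ _ _ _ _ _ _ => PairDvd.trans,
    fun _ _ _ _ _ _ hF hG => PairDvd.antisymm hF hG⟩

end StdPairsPaper
end
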